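/- arXiv:2603.23734 — 5 statements merged into one kernel-verified Lean document; each statement's English description precedes it below -/
import Mathlib

section
/- For every holomorphic function p on the open unit disc 𝔻 with Re p(z) > 0 for all z ∈ 𝔻, and for every 0 < r < 1, one has ∫₀^{2π} |z p'(z)/p(z)|² dθ ≤ π³ e^{-2} (1-r)^{-2}, where z = r e^{iθ}. -/
open Filter Set

/-- The integral mean `I_p(r) = ∫₀^{2π} |z p'(z)/p(z)|² dθ`, `z = r e^{iθ}`. -/
noncomputable def Ip (p : ℂ → ℂ) (r : ℝ) : ℝ :=
  ∫ θ in (0:ℝ)..(2 * Real.pi),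
    ‖(↑r * Complex.exp (↑θ * Complex.I)) * deriv p (↑r * Complex.exp (↑θ * Complex.I)) /
      p (↑r * Complex.exp (↑θ * Complex.I))‖ ^ 2

theorem integral_exp_int_mul_I (k : ℤ) :
    ∫ θ in (0:ℝ)..(2 * Real.pi), Complex.exp (k * θ * Complex.I) =
      if k = 0 then 2 * Real.pi else 0 := by
  split_ifs with hk
  · simp [hk]
  · have hc : (k * Complex.I : ℂ) ≠ 0 := by simp [hk]
    have h := integral_exp_mul_complex (a := 0) (b := 2 * Real.pi) hc
    have h1 : Complex.exp (k * Complex.I * ((2 * Real.pi : ℝ) : ℂ)) = 1 := by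
      rw [Complex.exp_eq_one_iff]
      exact ⟨k, by push_cast; ring⟩
    rw [h1] at h
    simp only [Complex.ofReal_zero, mul_zero, Complex.exp_zero, sub_self, zero_div] at h
    rw [Complex.ofReal_zero, ← h]
    congr 1 with θ
    ring_nf

theorem norm_exp_nat_mul_I (n : ℕ) (θ : ℝ) : ‖Complex.exp (n * θ * Complex.I)‖ = 1 := by
  have := Complex.norm_exp_ofReal_mul_I (n * θ)
  simpa using this

theorem continuous_of_hasSum_exp {b : ℕ → ℂ} {F : ℝ → ℂ} (hb : Summable fun n => ‖b n‖)
    (hF : ∀ θ : ℝ, HasSum (fun n : ℕ => b n * Complex.exp (n * θ * Complex.I)) (F θ)) :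
    Continuous F := by
  have h : F = fun θ : ℝ => ∑' n : ℕ, b n * Complex.exp (n * θ * Complex.I) :=
    funext fun θ => (hF θ).tsum_eq.symm
  rw [h]
  refine continuous_tsum (fun n => by fun_prop) hb fun n θ => ?_
  rw [norm_mul, norm_exp_nat_mul_I, mul_one]

theorem hasSum_integral_mul_exp {b : ℕ → ℂ} {F G : ℝ → ℂ} (hb : Summable fun n => ‖b n‖)
    (hF : ∀ θ : ℝ, HasSum (fun n : ℕ => b n * Complex.exp (n * θ * Complex.I)) (F θ))
    (hG : Continuous G) :
    HasSum (fun n : ℕ =>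
        b n * ∫ θ in (0:ℝ)..(2 * Real.pi), G θ * Complex.exp (n * θ * Complex.I))
      (∫ θ in (0:ℝ)..(2 * Real.pi), G θ * F θ) := by
  have h := intervalIntegral.hasSum_integral_of_dominated_convergence
    (μ := MeasureTheory.volume) (a := 0) (b := 2 * Real.pi)
    (F := fun (n : ℕ) (θ : ℝ) => b n * (G θ * Complex.exp (n * θ * Complex.I)))
    (f := fun θ => G θ * F θ) (fun n θ => ‖b n‖ * ‖G θ‖)
    (fun n => (by fun_prop : Continuous _).aestronglyMeasurable)
    (fun n => .of_forall fun θ _ => by simp [norm_exp_nat_mul_I])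
    (.of_forall fun θ _ => hb.mul_right _)
    (by
      simp_rw [tsum_mul_right]
      exact (by fun_prop : Continuous _).intervalIntegrable _ _)
    (.of_forall fun θ _ => by
      refine ((hF θ).mul_left (G θ)).congr_fun ?_
      intro n
      ring)
  simpa only [intervalIntegral.integral_const_mul] using h

/-- Parseval's identity for absolutely convergent one-sided trigonometric series. -/
theorem hasSum_sq_norm_of_hasSum_exp {b : ℕ → ℂ} {F : ℝ → ℂ} (hb : Summable fun n => ‖b n‖)
    (hF : ∀ θ : ℝ, HasSum (fun n : ℕ => b n * Complex.exp (n * θ * Complex.I)) (F θ)) :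
    HasSum (fun n : ℕ => 2 * Real.pi * ‖b n‖ ^ 2)
      (∫ θ in (0:ℝ)..(2 * Real.pi), ‖F θ‖ ^ 2) := by
  have hcont := continuous_of_hasSum_exp hb hF
  have coeff (m : ℕ) : ∫ θ in (0:ℝ)..(2 * Real.pi),
      Complex.exp (-(m * θ * Complex.I)) * F θ = 2 * Real.pi * b m := by
    have h := hasSum_integral_mul_exp hb hF
      (G := fun θ : ℝ => Complex.exp (-(m * θ * Complex.I))) (by fun_prop)
    refine h.unique ?_
    convert! hasSum_ite_eq m (2 * Real.pi * b m : ℂ) using 2 with n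
    have h2 := integral_exp_int_mul_I ((n : ℤ) - m)
    have h3 (θ : ℝ) : Complex.exp (-(m * θ * Complex.I)) * Complex.exp (n * θ * Complex.I) =
        Complex.exp (((n : ℤ) - m : ℤ) * θ * Complex.I) := by
      rw [← Complex.exp_add]
      push_cast
      ring_nf
    simp_rw [h3, h2]
    by_cases hnm : n = m
    · simp [hnm, mul_comm]
    · simp [hnm, sub_eq_zero]
  have h := hasSum_integral_mul_exp hb hF (G := fun θ => (starRingEnd ℂ) (F θ)) (by fun_prop)
  rw [← Complex.hasSum_ofReal, ← intervalIntegral.integral_ofReal]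
  convert! h using 2 with n
  · have h4 : ∫ θ in (0:ℝ)..(2 * Real.pi),
        (starRingEnd ℂ) (F θ) * Complex.exp (n * θ * Complex.I) =
        (starRingEnd ℂ) (2 * Real.pi * b n) := by
      rw [← coeff n, intervalIntegral.integral_of_le (by positivity),
        intervalIntegral.integral_of_le (by positivity), ← integral_conj]
      congr 1 with θ
      rw [map_mul, ← Complex.exp_conj, mul_comm]
      simp
    rw [h4, map_mul, mul_left_comm, Complex.mul_conj']
    simp [Complex.conj_ofNat]
  · ext θ
    rw [Complex.conj_mul']
    simp

theorem hasSum_sq_norm_circle {f : ℂ → ℂ} {a : ℕ → ℂ} {R : ℝ}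
    (hf : ∀ z ∈ Metric.ball (0:ℂ) 1, HasSum (fun n => a n * z ^ n) (f z))
    (hR0 : 0 ≤ R) (hR1 : R < 1) :
    HasSum (fun n : ℕ => 2 * Real.pi * (‖a n‖ * R ^ n) ^ 2)
      (∫ θ in (0:ℝ)..(2 * Real.pi), ‖f (R * Complex.exp (θ * Complex.I))‖ ^ 2) := by
  have hmem (θ : ℝ) : (R * Complex.exp (θ * Complex.I) : ℂ) ∈ Metric.ball (0:ℂ) 1 := by
    simpa [abs_of_nonneg hR0] using hR1
  have hs : Summable fun n => ‖a n * (R : ℂ) ^ n‖ := by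
    rw [summable_norm_iff]
    exact (hf R (by simpa [abs_of_nonneg hR0] using hR1)).summable
  have h := hasSum_sq_norm_of_hasSum_exp hs
    (F := fun θ : ℝ => f (R * Complex.exp (θ * Complex.I))) fun θ => by
      convert! hf _ (hmem θ) using 2 with n
      rw [mul_pow, ← Complex.exp_nat_mul]
      ring_nf
  simpa [abs_of_nonneg hR0] using h

theorem nat_mul_pow_le {x : ℝ} (hx0 : 0 < x) (hx1 : x < 1) (n : ℕ) :
    n * x ^ n ≤ Real.exp (-1) / (1 - x) := by
  rw [le_div_iff₀ (by linarith)]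
  have h1 : x ≤ Real.exp (-(1 - x)) := by
    have := Real.add_one_le_exp (-(1 - x))
    linarith
  have h2 : x ^ n ≤ Real.exp (-(n * (1 - x))) := by
    calc x ^ n ≤ Real.exp (-(1 - x)) ^ n := by gcongr
      _ = _ := by rw [← Real.exp_nat_mul]; ring_nf
  have h3 : n * (1 - x) ≤ Real.exp (n * (1 - x) - 1) := by
    have := Real.add_one_le_exp (n * (1 - x) - 1)
    linarith
  calc n * x ^ n * (1 - x) = (n * (1 - x)) * x ^ n := by ring
    _ ≤ Real.exp (n * (1 - x) - 1) * Real.exp (-(n * (1 - x))) := by gcongr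
    _ = Real.exp (-1) := by rw [← Real.exp_add]; ring_nf

theorem hasSum_taylor_unit_ball {f : ℂ → ℂ} (hf : DifferentiableOn ℂ f (Metric.ball 0 1)) {z : ℂ}
    (hz : z ∈ Metric.ball (0:ℂ) 1) :
    HasSum (fun n : ℕ => (n.factorial : ℂ)⁻¹ * iteratedDeriv n f 0 * z ^ n) (f z) := by
  convert! Complex.hasSum_taylorSeries_on_ball hf hz using 2 with n
  simp only [sub_zero, smul_eq_mul]
  ring

theorem hasSum_mul_deriv {f : ℂ → ℂ} (hf : DifferentiableOn ℂ f (Metric.ball 0 1)) {z : ℂ}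
    (hz : z ∈ Metric.ball (0:ℂ) 1) :
    HasSum (fun n : ℕ => (n * ((n.factorial : ℂ)⁻¹ * iteratedDeriv n f 0)) * z ^ n)
      (z * deriv f z) := by
  rw [← hasSum_nat_add_iff' 1]
  convert! (hasSum_taylor_unit_ball (hf.deriv Metric.isOpen_ball) hz).mul_left z using 1
  · ext n
    rw [← iteratedDeriv_succ', Nat.factorial_succ]
    have : (n + 1 : ℂ) ≠ 0 := by exact_mod_cast n.succ_ne_zero
    push_cast
    field_simp
    ring
  · simp

/-- If `|Im h| ≤ M` on the unit disc and `Re h(0) = 0`, then `∫ |h|² ≤ 4πM²` on circles. -/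
theorem integral_sq_norm_le_of_abs_im_le {h : ℂ → ℂ} {M R : ℝ}
    (hh : DifferentiableOn ℂ h (Metric.ball 0 1))
    (hM : ∀ z ∈ Metric.ball (0:ℂ) 1, |(h z).im| ≤ M) (h0 : (h 0).re = 0)
    (hR0 : 0 < R) (hR1 : R < 1) :
    ∫ θ in (0:ℝ)..(2 * Real.pi), ‖h (R * Complex.exp (θ * Complex.I))‖ ^ 2
      ≤ 4 * Real.pi * M ^ 2 := by
  have hmem (θ : ℝ) : (R * Complex.exp (θ * Complex.I) : ℂ) ∈ Metric.ball (0:ℂ) 1 := by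
    simpa [abs_of_pos hR0] using hR1
  have hcont : Continuous fun θ : ℝ => h (R * Complex.exp (θ * Complex.I)) :=
    hh.continuousOn.comp_continuous (by fun_prop) hmem
  have hmean : ∫ θ in (0:ℝ)..(2 * Real.pi), h (R * Complex.exp (θ * Complex.I)) ^ 2 =
      2 * Real.pi * h 0 ^ 2 := by
    have hd : DiffContOnCl ℂ (fun z => h z ^ 2) (Metric.ball 0 |R|) := by
      refine DifferentiableOn.diffContOnCl_ball (U := Metric.ball 0 1) (by fun_prop) ?_
      rw [abs_of_pos hR0]
      exact Metric.closedBall_subset_ball hR1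
    have := hd.circleAverage
    simp only [Real.circleAverage, circleMap, zero_add, Complex.real_smul] at this
    have hpi : (Real.pi : ℂ) ≠ 0 := by exact_mod_cast Real.pi_ne_zero
    rw [← this, ← mul_assoc]
    push_cast
    rw [mul_inv_cancel₀ (by simp [hpi]), one_mul]
  have hre : ∫ θ in (0:ℝ)..(2 * Real.pi), (h (R * Complex.exp (θ * Complex.I)) ^ 2).re ≤ 0 := by
    have e := congrArg Complex.re hmean
    have e2 := intervalIntegral.intervalIntegral_re (𝕜 := ℂ) (μ := MeasureTheory.volume)
      (f := fun θ : ℝ => h (R * Complex.exp (θ * Complex.I)) ^ 2) (a := 0) (b := 2 * Real.pi)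
      ((hcont.pow 2).intervalIntegrable _ _)
    simp only [RCLike.re_eq_complex_re] at e2
    rw [e2, e]
    have e3 : (2 * Real.pi * h 0 ^ 2 : ℂ).re = -(2 * Real.pi * (h 0).im ^ 2) := by
      simp [pow_two, h0]
    rw [e3]
    have := Real.pi_pos
    exact neg_nonpos.2 (by positivity)
  have key : ∀ θ : ℝ, ‖h (R * Complex.exp (θ * Complex.I))‖ ^ 2 ≤
      2 * M ^ 2 + (h (R * Complex.exp (θ * Complex.I)) ^ 2).re := fun θ => by
    have h1 := sq_le_sq' (abs_le.1 (hM _ (hmem θ))).1 (abs_le.1 (hM _ (hmem θ))).2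
    rw [← Complex.normSq_eq_norm_sq, Complex.normSq_apply, pow_two (h _), Complex.mul_re]
    nlinarith
  have hcre : Continuous fun θ : ℝ => (h (R * Complex.exp (θ * Complex.I)) ^ 2).re :=
    Complex.continuous_re.comp (hcont.pow 2)
  calc _ ≤ ∫ θ in (0:ℝ)..(2 * Real.pi),
        (2 * M ^ 2 + (h (R * Complex.exp (θ * Complex.I)) ^ 2).re) :=
        intervalIntegral.integral_mono_on (by positivity)
          ((hcont.norm.pow 2).intervalIntegrable _ _)
          ((continuous_const.add hcre).intervalIntegrable _ _) fun θ _ => key θ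
    _ = 4 * Real.pi * M ^ 2 +
        ∫ θ in (0:ℝ)..(2 * Real.pi), (h (R * Complex.exp (θ * Complex.I)) ^ 2).re := by
        rw [intervalIntegral.integral_add (by simp)
          (hcre.intervalIntegrable _ _), intervalIntegral.integral_const]
        simp only [sub_zero, smul_eq_mul]
        ring
    _ ≤ _ := by linarith

theorem integral_sq_norm_mul_deriv_le {f : ℂ → ℂ} (hf : DifferentiableOn ℂ f (Metric.ball 0 1))
    {r R : ℝ} (hr : 0 < r) (hrR : r < R) (hR : R < 1) :
    ∫ θ in (0:ℝ)..(2 * Real.pi), ‖(r * Complex.exp (θ * Complex.I)) *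
        deriv f (r * Complex.exp (θ * Complex.I))‖ ^ 2 ≤
      (Real.exp (-1) / (1 - r / R)) ^ 2 *
        ∫ θ in (0:ℝ)..(2 * Real.pi), ‖f (R * Complex.exp (θ * Complex.I))‖ ^ 2 := by
  have hR0 := hr.trans hrR
  have h1 := hasSum_sq_norm_circle (f := fun z => z * deriv f z)
    (fun z hz => hasSum_mul_deriv hf hz) hr.le (hrR.trans hR)
  have h2 := hasSum_sq_norm_circle (fun z hz => hasSum_taylor_unit_ball hf hz) hR0.le hR
  refine hasSum_le (fun n => ?_) h1 (h2.mul_left _)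
  have hb := nat_mul_pow_le (div_pos hr hR0) ((div_lt_one hR0).2 hrR) n
  have hpi := Real.pi_pos
  rw [norm_mul, Complex.norm_natCast]
  generalize ‖(n.factorial : ℂ)⁻¹ * iteratedDeriv n f 0‖ = c
  calc _ = (n * (r / R) ^ n) ^ 2 * (2 * Real.pi * (c * R ^ n) ^ 2) := by
        rw [div_pow]
        field_simp
    _ ≤ _ := by gcongr

/-- Uniform upper bound over the Carathéodory class:
`I_p(r) ≤ π³ e^{-2} (1-r)^{-2}`. -/
theorem stmt0 (p : ℂ → ℂ)
    (hp : DifferentiableOn ℂ p (Metric.ball (0:ℂ) 1))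
    (hre : ∀ z ∈ Metric.ball (0:ℂ) 1, 0 < (p z).re)
    (r : ℝ) (hr0 : 0 < r) (hr1 : r < 1) :
    Ip p r ≤ Real.pi ^ 3 * Real.exp (-2) / (1 - r) ^ 2 := by
  have hslit {z : ℂ} (hz : z ∈ Metric.ball (0:ℂ) 1) : p z ∈ Complex.slitPlane :=
    Or.inl (hre z hz)
  set h : ℂ → ℂ := fun z => Complex.log (p z) - (Real.log ‖p 0‖ : ℂ) with hh_def
  have hh : DifferentiableOn ℂ h (Metric.ball 0 1) :=
    (hp.clog fun z hz => hslit hz).sub_const _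
  have hderiv {z : ℂ} (hz : z ∈ Metric.ball (0:ℂ) 1) : deriv h z = deriv p z / p z := by
    have hd := (hp.differentiableAt (Metric.isOpen_ball.mem_nhds hz)).hasDerivAt
    exact ((hd.clog (hslit hz)).sub_const _).deriv
  have him : ∀ z ∈ Metric.ball (0:ℂ) 1, |(h z).im| ≤ Real.pi / 2 := fun z hz => by
    have := (Complex.abs_arg_lt_pi_div_two_iff.2 (Or.inl (hre z hz))).le
    simpa [hh_def, Complex.log_im] using this
  have h0 : (h 0).re = 0 := by simp [hh_def, Complex.log_re]
  have hIp : Ip p r = ∫ θ in (0:ℝ)..(2 * Real.pi), ‖(r * Complex.exp (θ * Complex.I)) *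
      deriv h (r * Complex.exp (θ * Complex.I))‖ ^ 2 := by
    unfold Ip
    congr 1 with θ
    rw [hderiv (by simpa [abs_of_pos hr0] using hr1), mul_div_assoc]
  have hbound : ∀ R ∈ Ioo r 1, Ip p r ≤
      (Real.exp (-1) / (1 - r / R)) ^ 2 * (4 * Real.pi * (Real.pi / 2) ^ 2) := fun R hR => by
    rw [hIp]
    refine (integral_sq_norm_mul_deriv_le hh hr0 hR.1 hR.2).trans ?_
    gcongr
    exact integral_sq_norm_le_of_abs_im_le hh him h0 (hr0.trans hR.1) hR.2
  have hlim : Tendsto (fun R : ℝ =>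
      (Real.exp (-1) / (1 - r / R)) ^ 2 * (4 * Real.pi * (Real.pi / 2) ^ 2))
      (nhdsWithin 1 (Iio 1))
      (nhds ((Real.exp (-1) / (1 - r / 1)) ^ 2 * (4 * Real.pi * (Real.pi / 2) ^ 2))) := by
    have hc : ContinuousAt (fun R : ℝ =>
        (Real.exp (-1) / (1 - r / R)) ^ 2 * (4 * Real.pi * (Real.pi / 2) ^ 2)) 1 := by
      have h1 : (1 - r / 1 : ℝ) ≠ 0 := by rw [div_one]; linarith
      fun_prop (disch := first | exact h1 | exact one_ne_zero)
    exact hc.tendsto.mono_left nhdsWithin_le_nhds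
  have hfin := ge_of_tendsto hlim (by
    filter_upwards [Ioo_mem_nhdsLT hr1] with R hR using hbound R hR)
  refine hfin.trans_eq ?_
  have he : Real.exp (-2) = Real.exp (-1) ^ 2 := by rw [← Real.exp_nat_mul]; norm_num
  rw [he, div_one, div_pow]
  ring
end

section
/- For each fixed holomorphic function p on the open unit disc 𝔻 with Re p(z) > 0 for all z ∈ 𝔻, one has (1-r)² · I_p(r) → 0 as r → 1⁻; that is, I_p(r) = o((1-r)^{-2}) as r → 1⁻. -/
open Filter Set

open scoped Nat in
/-- **Parseval's identity** for holomorphic functions on the unit disc. -/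
theorem hasSum_sq_norm_taylor_circleAverage {f : ℂ → ℂ}
    (hf : DifferentiableOn ℂ f (Metric.ball 0 1)) {r : ℝ} (hr0 : 0 < r) (hr1 : r < 1) :
    HasSum (fun n : ℕ => ‖(n ! : ℂ)⁻¹ * iteratedDeriv n f 0‖ ^ 2 * (r ^ n) ^ 2)
      (Real.circleAverage (fun z => ‖f z‖ ^ 2) 0 r) := by
  set c : ℕ → ℂ := fun n => (n ! : ℂ)⁻¹ * iteratedDeriv n f 0 * (r : ℂ) ^ n with hc
  have hball : ∀ w : ℂ, ‖w‖ = 1 → (r : ℂ) * w ∈ Metric.ball (0 : ℂ) 1 := fun w hw => by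
    simp [hw, abs_of_pos hr0, hr1]
  have hsum : ∀ w : ℂ, ‖w‖ = 1 → HasSum (fun n => c n * w ^ n) (f (r * w)) := fun w hw => by
    have h := Complex.hasSum_taylorSeries_on_ball hf (hball w hw)
    refine h.congr_fun fun n => ?_
    simp only [hc, sub_zero, smul_eq_mul, mul_pow]
    ring
  have hcn : Summable fun n => ‖c n‖ := by
    simpa using (hsum 1 (by simp)).summable.norm
  let P : ℕ → Polynomial ℂ := fun N => ∑ n ∈ Finset.range N, Polynomial.monomial n (c n)
  have hPcoeff : ∀ N i, (P N).coeff i = if i < N then c i else 0 := fun N i => by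
    simp [P, Polynomial.coeff_monomial]
  have hPeval : ∀ N w, (P N).eval w = ∑ n ∈ Finset.range N, c n * w ^ n := fun N w => by
    simp [P, Polynomial.eval_finsetSum]
  have hPars : ∀ N, ∑ n ∈ Finset.range N, ‖c n‖ ^ 2 =
      Real.circleAverage (fun w => ‖(P N).eval w‖ ^ 2) 0 1 := fun N => by
    rw [← Polynomial.sum_sq_norm_coeff_eq_circleAverage]
    symm
    refine (Finset.sum_subset (s₂ := Finset.range N) ?_ ?_).trans ?_
    · intro i hi
      rw [Polynomial.mem_support_iff, hPcoeff] at hi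
      exact Finset.mem_range.2 (by_contra fun h => hi (if_neg h))
    · intro i _ hi
      simp [Polynomial.notMem_support_iff.1 hi]
    · refine Finset.sum_congr rfl fun i hi => ?_
      rw [hPcoeff, if_pos (Finset.mem_range.1 hi)]
  have hterm : ∀ n : ℕ, ‖(n ! : ℂ)⁻¹ * iteratedDeriv n f 0‖ ^ 2 * (r ^ n) ^ 2 = ‖c n‖ ^ 2 :=
    fun n => by simp [hc, mul_pow, abs_of_pos hr0]
  simp_rw [hterm]
  rw [hasSum_iff_tendsto_nat_of_nonneg (fun n => by positivity)]
  simp_rw [hPars]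
  rw [Real.circleAverage_eq_circleAverage_zero_one (c := 0) (R := r)]
  simp only [Real.circleAverage_def]
  refine Tendsto.const_smul ?_ _
  have hcm : ∀ θ : ℝ, ‖circleMap 0 1 θ‖ = 1 := fun θ => by simp
  refine intervalIntegral.tendsto_integral_filter_of_dominated_convergence
    (fun _ => (∑' n, ‖c n‖) ^ 2) ?_ ?_ intervalIntegrable_const ?_
  · refine Eventually.of_forall fun N => Continuous.aestronglyMeasurable ?_
    exact ((P N).continuous.comp (continuous_circleMap 0 1)).norm.pow 2
  · refine Eventually.of_forall fun N => Eventually.of_forall fun θ _ => ?_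
    rw [norm_pow, norm_norm, hPeval]
    refine pow_le_pow_left₀ (norm_nonneg _) ?_ 2
    refine (norm_sum_le _ _).trans ?_
    simp only [norm_mul, norm_pow, hcm, one_pow, mul_one]
    exact hcn.sum_le_tsum _ fun _ _ => norm_nonneg _
  · refine Eventually.of_forall fun θ _ => ?_
    simp_rw [hPeval, add_zero]
    exact ((hsum _ (hcm θ)).tendsto_sum_nat.norm).pow 2

/-- The quadratic means of a holomorphic function on the unit disc with bounded imaginary part
are bounded. -/
theorem circleAverage_sq_norm_le_of_abs_im_le {f : ℂ → ℂ}
    (hf : DifferentiableOn ℂ f (Metric.ball 0 1)) {M : ℝ}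
    (hM : ∀ z ∈ Metric.ball (0 : ℂ) 1, |(f z).im| ≤ M) {r : ℝ} (hr0 : 0 < r) (hr1 : r < 1) :
    Real.circleAverage (fun z => ‖f z‖ ^ 2) 0 r ≤ 2 * M ^ 2 + ((f 0) ^ 2).re := by
  have hcl : Metric.closedBall (0 : ℂ) |r| ⊆ Metric.ball 0 1 :=
    Metric.closedBall_subset_ball (by rwa [abs_of_pos hr0])
  have hsph : Metric.sphere (0 : ℂ) |r| ⊆ Metric.ball 0 1 :=
    Metric.sphere_subset_closedBall.trans hcl
  have hcont : ContinuousOn f (Metric.sphere (0 : ℂ) |r|) := hf.continuousOn.mono hsph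
  have h1 : CircleIntegrable (fun z => ‖f z‖ ^ 2) 0 r := (hcont.norm.pow 2).circleIntegrable'
  have h2' : CircleIntegrable (fun z => f z ^ 2) 0 r := (hcont.pow 2).circleIntegrable'
  have h2 : CircleIntegrable (fun z => (f z ^ 2).re) 0 r :=
    (Complex.continuous_re.comp_continuousOn (hcont.pow 2)).circleIntegrable'
  have hmean : Real.circleAverage (fun z => f z ^ 2) 0 r = f 0 ^ 2 :=
    DiffContOnCl.circleAverage
      (DifferentiableOn.diffContOnCl_ball ((hf.pow 2).mono hcl) subset_rfl)
  have hre : Real.circleAverage (fun z => (f z ^ 2).re) 0 r = (f 0 ^ 2).re := by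
    rw [← hmean]
    exact Complex.reCLM.circleAverage_comp_comm h2'
  have hle := Real.circleAverage_mono_on_of_le_circle (h1.sub h2) (a := 2 * M ^ 2) fun z hz => by
    have := sq_le_sq' (neg_le_of_abs_le (hM z (hsph hz))) (le_of_abs_le (hM z (hsph hz)))
    simp only [Pi.sub_apply]
    rw [Complex.sq_norm, Complex.normSq_apply, sq (f z), Complex.mul_re]
    nlinarith
  rw [Real.circleAverage_sub h1 h2, hre] at hle
  linarith

open scoped Nat in
/-- The Taylor coefficients at `0` of a holomorphic function on the unit disc with bounded
imaginary part are square summable. -/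
theorem summable_sq_norm_taylor_of_abs_im_le {f : ℂ → ℂ}
    (hf : DifferentiableOn ℂ f (Metric.ball 0 1)) {M : ℝ}
    (hM : ∀ z ∈ Metric.ball (0 : ℂ) 1, |(f z).im| ≤ M) :
    Summable fun n : ℕ => ‖(n ! : ℂ)⁻¹ * iteratedDeriv n f 0‖ ^ 2 := by
  refine summable_of_sum_le (c := 2 * M ^ 2 + ((f 0) ^ 2).re) (fun n => by positivity) fun s => ?_
  have hlim : Tendsto (fun r : ℝ =>
      ∑ n ∈ s, ‖(n ! : ℂ)⁻¹ * iteratedDeriv n f 0‖ ^ 2 * (r ^ n) ^ 2) (nhdsWithin 1 (Set.Iio 1))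
      (nhds (∑ n ∈ s, ‖(n ! : ℂ)⁻¹ * iteratedDeriv n f 0‖ ^ 2 * ((1 : ℝ) ^ n) ^ 2)) := by
    refine Tendsto.mono_left (Continuous.tendsto ?_ 1) nhdsWithin_le_nhds
    fun_prop
  simp only [one_pow, mul_one] at hlim
  refine le_of_tendsto hlim ?_
  filter_upwards [Ioo_mem_nhdsLT (zero_lt_one' ℝ)] with r hr
  exact (sum_le_hasSum s (fun n _ => by positivity)
    (hasSum_sq_norm_taylor_circleAverage hf hr.1 hr.2)).trans
    (circleAverage_sq_norm_le_of_abs_im_le hf hM hr.1 hr.2)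

theorem one_sub_mul_nat_mul_pow_le_one {r : ℝ} (hr0 : 0 ≤ r) (hr1 : r ≤ 1) (n : ℕ) :
    (1 - r) * (n * r ^ n) ≤ 1 := by
  have h : (n : ℝ) * r ^ n ≤ ∑ i ∈ Finset.range n, r ^ i := by
    rw [← nsmul_eq_mul]
    simpa using Finset.card_nsmul_le_sum (Finset.range n) (fun i => r ^ i) (r ^ n)
      fun i hi => pow_le_pow_of_le_one hr0 hr1 (Finset.mem_range.1 hi).le
  calc (1 - r) * (n * r ^ n) ≤ (1 - r) * ∑ i ∈ Finset.range n, r ^ i :=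
        mul_le_mul_of_nonneg_left h (by linarith)
    _ = 1 - r ^ n := mul_neg_geom_sum r n
    _ ≤ 1 := by linarith [pow_nonneg hr0 n]

/-- Abelian estimate: square summable coefficients have
`(1 - r)² ∑ n² |aₙ|² r²ⁿ → 0` as `r → 1⁻`. -/
theorem tendsto_tsum_sq_one_sub_mul_nat_mul_pow {b : ℕ → ℝ} (hb0 : ∀ n, 0 ≤ b n)
    (hb : Summable b) :
    Tendsto (fun r : ℝ => ∑' n, b n * ((1 - r) * (n * r ^ n)) ^ 2)
      (nhdsWithin 1 (Set.Iio 1)) (nhds 0) := by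
  have hlim : ∀ n, Tendsto (fun r : ℝ => b n * ((1 - r) * (n * r ^ n)) ^ 2)
      (nhdsWithin 1 (Set.Iio 1)) (nhds 0) := fun n => by
    have hc : Continuous fun r : ℝ => b n * ((1 - r) * (n * r ^ n)) ^ 2 := by fun_prop
    simpa using (hc.tendsto 1).mono_left nhdsWithin_le_nhds
  rw [← tsum_zero (α := ℝ) (β := ℕ)]
  refine tendsto_tsum_of_dominated_convergence hb hlim ?_
  filter_upwards [Ioo_mem_nhdsLT (zero_lt_one' ℝ)] with r hr n
  have h0 : 0 ≤ (1 - r) * (n * r ^ n) :=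
    mul_nonneg (by linarith [hr.2]) (mul_nonneg n.cast_nonneg (pow_nonneg hr.1.le n))
  rw [Real.norm_of_nonneg (mul_nonneg (hb0 n) (sq_nonneg _))]
  exact mul_le_of_le_one_right (hb0 n)
    (pow_le_one₀ h0 (one_sub_mul_nat_mul_pow_le_one hr.1.le hr.2.le n))

/-- Little-o refinement for each fixed Carathéodory function:
`(1-r)² I_p(r) → 0` as `r → 1⁻`. -/
theorem stmt1 (p : ℂ → ℂ)
    (hp : DifferentiableOn ℂ p (Metric.ball (0:ℂ) 1))
    (hre : ∀ z ∈ Metric.ball (0:ℂ) 1, 0 < (p z).re) :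
    Tendsto (fun r : ℝ => (1 - r) ^ 2 * Ip p r) (nhdsWithin 1 (Set.Iio 1)) (nhds 0) := by
  set f : ℂ → ℂ := fun z => Complex.log (p z)
  have hslit : ∀ z ∈ Metric.ball (0 : ℂ) 1, p z ∈ Complex.slitPlane := fun z hz => Or.inl (hre z hz)
  have hf : DifferentiableOn ℂ f (Metric.ball 0 1) := hp.clog hslit
  have hf' : DifferentiableOn ℂ (deriv f) (Metric.ball 0 1) := hf.deriv Metric.isOpen_ball
  have hderiv : ∀ z ∈ Metric.ball (0 : ℂ) 1, deriv f z = deriv p z / p z := fun z hz =>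
    ((hp.differentiableAt (Metric.isOpen_ball.mem_nhds hz)).hasDerivAt.clog (hslit z hz)).deriv
  have hM : ∀ z ∈ Metric.ball (0 : ℂ) 1, |(f z).im| ≤ Real.pi / 2 := fun z hz => by
    rw [Complex.log_im, Complex.abs_arg_le_pi_div_two_iff]
    exact (hre z hz).le
  have hsum := summable_sq_norm_taylor_of_abs_im_le hf hM
  have hlim := (tendsto_tsum_sq_one_sub_mul_nat_mul_pow (fun n => by positivity) hsum).const_mul
    (2 * Real.pi)
  rw [mul_zero] at hlim
  refine hlim.congr' ?_
  filter_upwards [Ioo_mem_nhdsLT (zero_lt_one' ℝ)] with r hr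
  have hIp : Ip p r = 2 * Real.pi * r ^ 2 *
      Real.circleAverage (fun z => ‖deriv f z‖ ^ 2) 0 r := by
    rw [Real.circleAverage_def, smul_eq_mul, mul_assoc, mul_left_comm (r ^ 2),
      mul_inv_cancel_left₀ (by positivity), ← intervalIntegral.integral_const_mul]
    refine intervalIntegral.integral_congr fun θ _ => ?_
    have hmem : (r : ℂ) * Complex.exp (θ * Complex.I) ∈ Metric.ball (0 : ℂ) 1 := by
      simp [Complex.norm_exp_ofReal_mul_I, abs_of_pos hr.1, hr.2]
    simp only [circleMap, zero_add]
    rw [hderiv _ hmem, mul_div_assoc, norm_mul, mul_pow, norm_mul, Complex.norm_exp_ofReal_mul_I,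
      mul_one, Complex.norm_real, Real.norm_eq_abs, sq_abs]
  have hS := (hasSum_sq_norm_taylor_circleAverage hf' hr.1 hr.2).mul_left ((1 - r) ^ 2 * r ^ 2)
  have hT : HasSum (fun n : ℕ => ‖((n + 1).factorial : ℂ)⁻¹ * iteratedDeriv (n + 1) f 0‖ ^ 2 *
      ((1 - r) * ((n + 1 : ℕ) * r ^ (n + 1))) ^ 2)
      ((1 - r) ^ 2 * r ^ 2 * Real.circleAverage (fun z => ‖deriv f z‖ ^ 2) 0 r) := by
    refine hS.congr_fun fun n => ?_
    have hn : (n + 1 : ℝ) ≠ 0 := by positivity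
    rw [← iteratedDeriv_succ', Nat.factorial_succ]
    simp only [norm_mul, norm_inv, Complex.norm_natCast, Nat.cast_mul]
    push_cast
    field_simp
    ring
  have hU := (hasSum_nat_add_iff (f := fun n : ℕ => ‖(n.factorial : ℂ)⁻¹ *
    iteratedDeriv n f 0‖ ^ 2 * ((1 - r) * (n * r ^ n)) ^ 2) 1).1 hT
  rw [hU.tsum_eq, hIp]
  simp only [Finset.sum_range_one, Nat.cast_zero, zero_mul, mul_zero, ne_eq, OfNat.ofNat_ne_zero,
    not_false_eq_true, zero_pow, add_zero]
  ring
end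

section
/- For every real α < 2 there is no constant C_α > 0 such that I_p(r) ≤ C_α (1-r)^{-α} holds for all holomorphic functions p on the open unit disc 𝔻 with Re p > 0 on 𝔻 and all 0 < r < 1. Hence 2 is the least exponent α for which a uniform estimate I_p(r) ≤ C_α (1-r)^{-α} over the whole Carathéodory class can hold. -/
open Filter Set

/-- Schwarz–Pick type bound for the logarithmic derivative of a function with positive real part. -/
lemma norm_deriv_div_le_of_re_pos {p : ℂ → ℂ} (hd : DifferentiableOn ℂ p (Metric.ball (0:ℂ) 1))
    (hp : ∀ z ∈ Metric.ball (0:ℂ) 1, 0 < (p z).re) {z : ℂ} (hz : ‖z‖ < 1) :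
    ‖deriv p z / p z‖ ≤ 2 / (1 - ‖z‖) := by
  have hR : 0 < 1 - ‖z‖ := by linarith
  have hsub : Metric.ball z (1 - ‖z‖) ⊆ Metric.ball (0:ℂ) 1 := by
    intro w hw
    rw [mem_ball_iff_norm] at hw
    rw [mem_ball_zero_iff]
    have := norm_add_le (w - z) z
    rw [sub_add_cancel] at this
    linarith
  have hz1 : z ∈ Metric.ball (0:ℂ) 1 := by simpa using hz
  have ha : 0 < (p z).re := hp z hz1
  have hne : ∀ w ∈ Metric.ball (0:ℂ) 1, p w + (starRingEnd ℂ) (p z) ≠ 0 := by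
    intro w hw h
    have := congrArg Complex.re h
    simp at this
    linarith [hp w hw]
  have hdiff : DifferentiableOn ℂ (fun w => (p w - p z) / (p w + (starRingEnd ℂ) (p z)))
      (Metric.ball z (1 - ‖z‖)) :=
    ((hd.mono hsub).sub_const _).div ((hd.mono hsub).add_const _) fun w hw => hne w (hsub hw)
  have hmaps : MapsTo (fun w => (p w - p z) / (p w + (starRingEnd ℂ) (p z)))
      (Metric.ball z (1 - ‖z‖))
      (Metric.ball ((p z - p z) / (p z + (starRingEnd ℂ) (p z))) 1) := by
    intro w hw
    have hw' := hp w (hsub hw)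
    rw [sub_self, zero_div, mem_ball_zero_iff, norm_div,
      div_lt_one (norm_pos_iff.2 (hne w (hsub hw)))]
    refine lt_of_pow_lt_pow_left₀ 2 (norm_nonneg _) ?_
    rw [Complex.sq_norm, Complex.sq_norm, Complex.normSq_apply, Complex.normSq_apply]
    simp only [Complex.sub_re, Complex.sub_im, Complex.add_re, Complex.add_im, Complex.conj_re,
      Complex.conj_im]
    nlinarith [mul_pos hw' ha]
  have key := Complex.norm_deriv_le_div_of_mapsTo_ball hdiff
    (hmaps.mono_right Metric.ball_subset_closedBall) hR
  have hpd : HasDerivAt p (deriv p z) z :=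
    (hd.differentiableAt (Metric.isOpen_ball.mem_nhds hz1)).hasDerivAt
  have hder := ((hpd.sub_const (p z)).div (hpd.add_const ((starRingEnd ℂ) (p z))) (hne z hz1)).deriv
  have hsum : p z + (starRingEnd ℂ) (p z) = ((2 * (p z).re : ℝ) : ℂ) := Complex.add_conj _
  have hder' : deriv (fun w => (p w - p z) / (p w + (starRingEnd ℂ) (p z))) z
      = deriv p z / ((2 * (p z).re : ℝ) : ℂ) := by
    refine hder.trans ?_
    have h0 := hne z hz1
    rw [← hsum]
    field_simp
    ring
  rw [hder', norm_div, Complex.norm_real, Real.norm_of_nonneg (by positivity),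
    div_le_div_iff₀ (by positivity) hR] at key
  have hle : (p z).re ≤ ‖p z‖ := Complex.re_le_norm _
  rw [norm_div, div_le_div_iff₀ (by linarith) hR]
  linarith

lemma Ip_le {p : ℂ → ℂ} (hd : DifferentiableOn ℂ p (Metric.ball (0:ℂ) 1))
    (hp : ∀ z ∈ Metric.ball (0:ℂ) 1, 0 < (p z).re) {r : ℝ} (h0 : 0 < r) (h1 : r < 1) :
    Ip p r ≤ 8 * Real.pi * (1 - r) ^ (-2 : ℝ) := by
  have hR : 0 < 1 - r := by linarith
  have hb := intervalIntegral.norm_integral_le_of_norm_le_const (a := 0) (b := 2 * Real.pi)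
    (f := fun θ : ℝ => ‖(↑r * Complex.exp (↑θ * Complex.I)) *
      deriv p (↑r * Complex.exp (↑θ * Complex.I)) / p (↑r * Complex.exp (↑θ * Complex.I))‖ ^ 2)
    (C := (2 / (1 - r)) ^ 2) (by
      intro θ _
      have hn : ‖(r : ℂ) * Complex.exp (↑θ * Complex.I)‖ = r := by
        rw [norm_mul, Complex.norm_exp_ofReal_mul_I, Complex.norm_real, Real.norm_of_nonneg h0.le,
          mul_one]
      have := norm_deriv_div_le_of_re_pos hd hp (hn.trans_lt h1)
      rw [hn] at this
      rw [norm_pow, norm_norm, mul_div_assoc, norm_mul, hn]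
      refine pow_le_pow_left₀ (by positivity) ?_ 2
      exact (mul_le_of_le_one_left (norm_nonneg _) h1.le).trans this)
  refine (le_abs_self _).trans (hb.trans_eq ?_)
  rw [sub_zero, abs_of_pos Real.two_pi_pos, Real.rpow_neg hR.le, Real.rpow_two]
  field_simp
  ring

lemma re_one_add_pow_pos {n : ℕ} (hn : n ≠ 0) {z : ℂ} (hz : ‖z‖ < 1) : 0 < (1 + z ^ n).re := by
  have h1 : ‖z ^ n‖ < 1 := by
    rw [norm_pow]; exact pow_lt_one₀ (norm_nonneg _) hz hn
  have h2 := (abs_le.1 (Complex.abs_re_le_norm (z ^ n))).1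
  rw [Complex.add_re, Complex.one_re]
  linarith

lemma le_Ip_one_add_pow {n : ℕ} (hn : n ≠ 0) {r : ℝ} (h0 : 0 < r) (h1 : r < 1) :
    2 * Real.pi * (n * r ^ n / 2) ^ 2 ≤ Ip (fun z => 1 + z ^ n) r := by
  have hnorm : ∀ θ : ℝ, ‖(r : ℂ) * Complex.exp (↑θ * Complex.I)‖ = r := fun θ => by
    rw [norm_mul, Complex.norm_exp_ofReal_mul_I, Complex.norm_real, Real.norm_of_nonneg h0.le,
      mul_one]
  have hne : ∀ z : ℂ, ‖z‖ = r → 1 + z ^ n ≠ 0 := fun z hz h => by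
    have := re_one_add_pow_pos hn (hz.trans_lt h1)
    rw [h] at this
    simp at this
  have hder : ∀ z : ℂ, deriv (fun z : ℂ => 1 + z ^ n) z = n * z ^ (n - 1) := fun z => by simp
  have hlow : ∀ z : ℂ, ‖z‖ = r →
      (n * r ^ n / 2) ^ 2 ≤ ‖z * (n * z ^ (n - 1)) / (1 + z ^ n)‖ ^ 2 := fun z hz => by
    refine pow_le_pow_left₀ (by positivity) ?_ 2
    have hmul : z * (n * z ^ (n - 1)) = n * z ^ n := by
      rw [mul_left_comm, mul_pow_sub_one hn]
    rw [hmul, norm_div, norm_mul, norm_pow, hz, Complex.norm_natCast]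
    refine div_le_div_of_nonneg_left (by positivity) (norm_pos_iff.2 (hne z hz)) ?_
    refine (norm_add_le _ _).trans ?_
    rw [norm_one, norm_pow, hz]
    linarith [pow_le_one₀ (n := n) h0.le h1.le]
  unfold Ip
  simp only [hder]
  have hint := intervalIntegral.integral_mono_on (μ := MeasureTheory.volume) Real.two_pi_pos.le
    (f := fun _ => (n * r ^ n / 2) ^ 2)
    (g := fun θ : ℝ => ‖(↑r * Complex.exp (↑θ * Complex.I)) *
      (n * (↑r * Complex.exp (↑θ * Complex.I)) ^ (n - 1)) /
        (1 + (↑r * Complex.exp (↑θ * Complex.I)) ^ n)‖ ^ 2)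
    (continuous_const.intervalIntegrable _ _)
    (Continuous.intervalIntegrable (by
      refine (Continuous.norm ?_).pow 2
      refine Continuous.div (by fun_prop) (by fun_prop) fun θ => hne _ (hnorm θ)) _ _)
    fun θ _ => hlow _ (hnorm θ)
  simpa using hint

lemma not_exists_uniform_Ip_bound {α : ℝ} (hα : α < 2) :
    ¬ ∃ C : ℝ, 0 < C ∧ ∀ p : ℂ → ℂ, DifferentiableOn ℂ p (Metric.ball (0:ℂ) 1) →
      (∀ z ∈ Metric.ball (0:ℂ) 1, 0 < (p z).re) →
      ∀ r : ℝ, 0 < r → r < 1 → Ip p r ≤ C * (1 - r) ^ (-α) := by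
  rintro ⟨C, -, hC⟩
  have hlim : Tendsto (fun m : ℕ => ((2 * m : ℕ) : ℝ) ^ (2 - α)) atTop atTop :=
    (tendsto_rpow_atTop (by linarith)).comp <| tendsto_natCast_atTop_atTop.comp <|
      tendsto_id.const_mul_atTop' two_pos
  obtain ⟨m, hm, hm1⟩ :=
    ((hlim.eventually_gt_atTop (C * 32 / Real.pi)).and (eventually_ge_atTop 1)).exists
  have hm' : (1 : ℝ) ≤ m := by exact_mod_cast hm1
  set x : ℝ := ((2 * m : ℕ) : ℝ) with hx
  have hx2 : x = 2 * m := by simp [hx]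
  have hx0 : 0 < x := by linarith
  have hxinv : x⁻¹ ≤ 1 / 2 := by
    rw [one_div]; exact inv_anti₀ two_pos (by linarith)
  have hxpos : 0 < x⁻¹ := inv_pos.2 hx0
  have hr0 : 0 < 1 - x⁻¹ := by linarith
  have hr1 : 1 - x⁻¹ < 1 := by linarith
  have hn : 2 * m ≠ 0 := by omega
  have hup := hC (fun z => 1 + z ^ (2 * m)) (by fun_prop)
    (fun z hz => re_one_add_pow_pos hn (by simpa using hz)) _ hr0 hr1
  have hlow := le_Ip_one_add_pow hn hr0 hr1
  rw [← hx] at hlow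
  have hbern : 1 / 2 ≤ (1 - x⁻¹) ^ m := by
    have := one_add_mul_le_pow (a := -x⁻¹) (by linarith) m
    have h2 : (m : ℝ) * -x⁻¹ = -(1 / 2) := by rw [hx2]; field_simp
    rw [h2] at this
    rw [sub_eq_add_neg]
    linarith
  have hpow : 1 / 4 ≤ (1 - x⁻¹) ^ (2 * m) := by
    rw [mul_comm, pow_mul]
    nlinarith
  have hsq : (x * (1 / 4) / 2) ^ 2 ≤ (x * (1 - x⁻¹) ^ (2 * m) / 2) ^ 2 := by gcongr
  have hmain : 2 * Real.pi * (x * (1 / 4) / 2) ^ 2 ≤ C * x ^ α := by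
    have hrp : (1 - (1 - x⁻¹)) ^ (-α) = x ^ α := by
      rw [sub_sub_cancel, Real.inv_rpow hx0.le, Real.rpow_neg hx0.le, inv_inv]
    rw [← hrp]
    exact (mul_le_mul_of_nonneg_left hsq Real.two_pi_pos.le).trans (hlow.trans hup)
  rw [div_lt_iff₀ Real.pi_pos, Real.rpow_sub hx0, Real.rpow_two, div_mul_eq_mul_div,
    lt_div_iff₀ (Real.rpow_pos_of_pos hx0 _)] at hm
  nlinarith

/-- `2` is the least exponent `α` for which a uniform estimate
`I_p(r) ≤ C_α (1-r)^{-α}` over the whole Carathéodory class can hold. -/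
theorem stmt4 :
    (∀ α : ℝ, α < 2 →
      ¬ ∃ C : ℝ, 0 < C ∧ ∀ p : ℂ → ℂ, DifferentiableOn ℂ p (Metric.ball (0:ℂ) 1) →
        (∀ z ∈ Metric.ball (0:ℂ) 1, 0 < (p z).re) →
        ∀ r : ℝ, 0 < r → r < 1 → Ip p r ≤ C * (1 - r) ^ (-α)) ∧
    IsLeast {α : ℝ | ∃ C : ℝ, 0 < C ∧ ∀ p : ℂ → ℂ,
        DifferentiableOn ℂ p (Metric.ball (0:ℂ) 1) →
        (∀ z ∈ Metric.ball (0:ℂ) 1, 0 < (p z).re) →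
        ∀ r : ℝ, 0 < r → r < 1 → Ip p r ≤ C * (1 - r) ^ (-α)} 2 := by
  refine ⟨fun α hα => not_exists_uniform_Ip_bound hα, ⟨8 * Real.pi, by positivity, ?_⟩, ?_⟩
  · intro p hd hp r h0 h1
    exact Ip_le hd hp h0 h1
  · intro α hα
    by_contra! h
    exact not_exists_uniform_Ip_bound h hα
end

section
/- Define F*(z) = (i/2) ∑_{k=1}^{∞} z^{2^k}/k² for z in the closed unit disc. Then the series converges absolutely and uniformly on the closed unit disc, |Im F*(z)| ≤ π²/12 < π/2 for all |z| ≤ 1, and the function p*(z) = e^{F*(z)} is holomorphic on the open unit disc 𝔻 with Re p*(z) > 0 for all z ∈ 𝔻. -/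
open Filter Set

theorem hasSum_one_div_succ_sq :
    HasSum (fun k : ℕ => 1 / ((k : ℝ) + 1) ^ 2) (Real.pi ^ 2 / 6) := by
  simpa using (hasSum_nat_add_iff' 1).mpr hasSum_zeta_two

theorem norm_lacunary_term_le {z : ℂ} (hz : z ∈ Metric.closedBall (0 : ℂ) 1) (k : ℕ) :
    ‖z ^ (2 ^ (k + 1)) / ((k : ℂ) + 1) ^ 2‖ ≤ 1 / ((k : ℝ) + 1) ^ 2 := by
  have hk : ‖(k : ℂ) + 1‖ = (k : ℝ) + 1 := by
    exact_mod_cast Complex.norm_natCast (k + 1)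
  rw [norm_div, norm_pow, norm_pow, hk]
  gcongr
  exact pow_le_one₀ (norm_nonneg z) (mem_closedBall_zero_iff.mp hz)

theorem abs_im_I_div_two_mul_lacunarySeries_le (z : ℂ) (hz : z ∈ Metric.closedBall (0 : ℂ) 1) :
    |(Complex.I / 2 * ∑' k : ℕ, z ^ (2 ^ (k + 1)) / ((k : ℂ) + 1) ^ 2).im|
      ≤ Real.pi ^ 2 / 12 := by
  have h := tsum_of_norm_bounded hasSum_one_div_succ_sq (norm_lacunary_term_le hz)
  refine (Complex.abs_im_le_norm _).trans ?_
  rw [norm_mul, norm_div, Complex.norm_I, Complex.norm_ofNat]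
  linarith

theorem differentiableOn_lacunarySeries :
    DifferentiableOn ℂ (fun z : ℂ => ∑' k : ℕ, z ^ (2 ^ (k + 1)) / ((k : ℂ) + 1) ^ 2)
      (Metric.ball (0 : ℂ) 1) :=
  Complex.differentiableOn_tsum_of_summable_norm hasSum_one_div_succ_sq.summable
    (fun _ => by fun_prop) Metric.isOpen_ball
    fun k _ hz => norm_lacunary_term_le (Metric.ball_subset_closedBall hz) k

/-- The lacunary series `F*(z) = (i/2) ∑_{k≥1} z^{2^k}/k²` (here indexed by
`k+1`, `k : ℕ`) converges absolutely and uniformly on the closed unit disc,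
satisfies `|Im F*| ≤ π²/12 < π/2` there, and `p* = e^{F*}` lies in the
Carathéodory class. -/
theorem stmt11 :
    (∀ z ∈ Metric.closedBall (0:ℂ) 1,
      Summable (fun k : ℕ => ‖z ^ (2 ^ (k + 1)) / ((k : ℂ) + 1) ^ 2‖)) ∧
    TendstoUniformlyOn
      (fun N : ℕ => fun z : ℂ => ∑ k ∈ Finset.range N, z ^ (2 ^ (k + 1)) / ((k : ℂ) + 1) ^ 2)
      (fun z : ℂ => ∑' k : ℕ, z ^ (2 ^ (k + 1)) / ((k : ℂ) + 1) ^ 2)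
      atTop (Metric.closedBall (0:ℂ) 1) ∧
    (∀ z ∈ Metric.closedBall (0:ℂ) 1,
      |((Complex.I / 2 * ∑' k : ℕ, z ^ (2 ^ (k + 1)) / ((k : ℂ) + 1) ^ 2)).im|
        ≤ Real.pi ^ 2 / 12) ∧
    Real.pi ^ 2 / 12 < Real.pi / 2 ∧
    DifferentiableOn ℂ
      (fun z : ℂ => Complex.exp (Complex.I / 2 * ∑' k : ℕ, z ^ (2 ^ (k + 1)) / ((k : ℂ) + 1) ^ 2))
      (Metric.ball (0:ℂ) 1) ∧
    ∀ z ∈ Metric.ball (0:ℂ) 1,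
      0 < (Complex.exp (Complex.I / 2 * ∑' k : ℕ, z ^ (2 ^ (k + 1)) / ((k : ℂ) + 1) ^ 2)).re := by
  have hdiff := differentiableOn_lacunarySeries
  have him := abs_im_I_div_two_mul_lacunarySeries_le
  have hpi : Real.pi ^ 2 / 12 < Real.pi / 2 := by nlinarith [Real.pi_pos, Real.pi_lt_four]
  refine ⟨fun z hz => ?_, ?_, him, hpi, ?_, fun z hz => ?_⟩
  · exact hasSum_one_div_succ_sq.summable.of_nonneg_of_le (fun _ => norm_nonneg _)
      fun k => norm_lacunary_term_le hz k
  · exact tendstoUniformlyOn_tsum_nat hasSum_one_div_succ_sq.summable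
      fun k z hz => norm_lacunary_term_le hz k
  · exact (hdiff.const_mul _).cexp
  · have h := abs_le.mp (him z (Metric.ball_subset_closedBall hz))
    rw [Complex.exp_re]
    exact mul_pos (Real.exp_pos _)
      (Real.cos_pos_of_mem_Ioo ⟨by linarith [h.1], by linarith [h.2]⟩)
end

section
/- Let F*(z) = (i/2) ∑_{k=1}^{∞} z^{2^k}/k² and p*(z) = e^{F*(z)} on the open unit disc 𝔻. Then z p*'(z)/p*(z) = (i/2) ∑_{k=1}^{∞} (2^k/k²) z^{2^k}, and for every 0 < r < 1, ∫₀^{2π} |z p*'(z)/p*(z)|² dθ = 2π ∑_{k=1}^{∞} (4^{k-1}/k⁴) r^{2^{k+1}}, where z = r e^{iθ}. -/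
open Filter Set

open ComplexConjugate in
/-- Orthogonality of the characters `θ ↦ e^{i n θ}` on `[0, 2π]`. -/
theorem integral_exp_mul_conj_exp (m n : ℕ) :
    ∫ θ in (0:ℝ)..(2 * Real.pi), Complex.exp (θ * Complex.I) ^ m *
      conj (Complex.exp (θ * Complex.I) ^ n) = if m = n then 2 * (Real.pi : ℂ) else 0 := by
  have key (θ : ℝ) : Complex.exp (θ * Complex.I) ^ m * conj (Complex.exp (θ * Complex.I) ^ n)
      = Complex.exp (((m : ℂ) - n) * Complex.I * θ) := by
    rw [map_pow, ← Complex.exp_conj, ← Complex.exp_nat_mul, ← Complex.exp_nat_mul,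
      ← Complex.exp_add]
    congr 1
    simp only [map_mul, Complex.conj_I, Complex.conj_ofReal]
    ring
  simp_rw [key]
  split_ifs with h
  · simp [h]
  · have hc : ((m : ℂ) - n) * Complex.I ≠ 0 :=
      mul_ne_zero (sub_ne_zero.2 (Nat.cast_injective.ne h)) Complex.I_ne_zero
    rw [integral_exp_mul_complex hc]
    have h1 : Complex.exp (((m : ℂ) - n) * Complex.I * ((2 * Real.pi : ℝ) : ℂ)) = 1 :=
      Complex.exp_eq_one_iff.2 ⟨(m : ℤ) - n, by push_cast; ring⟩
    rw [h1, Complex.ofReal_zero, mul_zero, Complex.exp_zero, sub_self, zero_div]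

open ComplexConjugate in
/-- Parseval's identity for an absolutely convergent trigonometric series. -/
theorem hasSum_integral_norm_tsum_sq {a : ℕ → ℂ} (ha : Summable fun k => ‖a k‖) {n : ℕ → ℕ}
    (hn : Function.Injective n) :
    HasSum (fun k => 2 * Real.pi * ‖a k‖ ^ 2)
      (∫ θ in (0:ℝ)..(2 * Real.pi), ‖∑' k, a k * Complex.exp (θ * Complex.I) ^ n k‖ ^ 2) := by
  let F : ℕ → C(ℝ, ℂ) := fun k =>
    ⟨fun θ => a k * Complex.exp (θ * Complex.I) ^ n k, by fun_prop⟩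
  let G : ℕ × ℕ → C(ℝ, ℂ) := fun p =>
    ⟨fun θ => F p.1 θ * conj (F p.2 θ),
      (F p.1).continuous.mul (Complex.continuous_conj.comp (F p.2).continuous)⟩
  have hF (k : ℕ) (θ : ℝ) : ‖F k θ‖ = ‖a k‖ := by
    simp [F, Complex.norm_exp_ofReal_mul_I]
  have hsF (θ : ℝ) : Summable fun k => ‖F k θ‖ := by simpa only [hF] using ha
  have hG (p : ℕ × ℕ) (θ : ℝ) : ‖G p θ‖ = ‖a p.1‖ * ‖a p.2‖ := by
    simp only [G, ContinuousMap.coe_mk, norm_mul, RCLike.norm_conj, hF]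
  have hsum : Summable fun p : ℕ × ℕ => ‖a p.1‖ * ‖a p.2‖ :=
    ha.mul_of_nonneg ha (fun _ => norm_nonneg _) (fun _ => norm_nonneg _)
  have hG' : Summable fun p => ‖(G p).restrict
      (⟨uIcc 0 (2 * Real.pi), isCompact_uIcc⟩ : TopologicalSpace.Compacts ℝ)‖ := by
    refine hsum.of_nonneg_of_le (fun _ => norm_nonneg _) fun p => ?_
    exact (ContinuousMap.norm_le _ (by positivity)).2 fun x => (hG p x).le
  have hseries := intervalIntegral.hasSum_intervalIntegral_of_summable_norm hG'
  have htsum (θ : ℝ) : ∑' p, G p θ =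
      ((‖∑' k, a k * Complex.exp (θ * Complex.I) ^ n k‖ ^ 2 : ℝ) : ℂ) := by
    have hconj : Summable fun k => ‖conj (F k θ)‖ := by
      simpa only [RCLike.norm_conj] using hsF θ
    have := tsum_mul_tsum_of_summable_norm (hsF θ) hconj
    rw [← Complex.conj_tsum, Complex.mul_conj'] at this
    push_cast
    exact this.symm
  have hdiag (p : ℕ × ℕ) : ∫ θ in (0:ℝ)..(2 * Real.pi), G p θ =
      a p.1 * conj (a p.2) * if n p.1 = n p.2 then 2 * (Real.pi : ℂ) else 0 := by
    rw [← integral_exp_mul_conj_exp, ← intervalIntegral.integral_const_mul]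
    congr 1
    ext θ
    simp only [G, F, ContinuousMap.coe_mk, map_mul]
    ring
  simp_rw [htsum, hdiag] at hseries
  rw [intervalIntegral.integral_ofReal] at hseries
  have hinj : Function.Injective fun k : ℕ => (k, k) := fun _ _ h => congrArg Prod.fst h
  rw [← hinj.hasSum_iff] at hseries
  · rw [← Complex.hasSum_ofReal]
    have hterm : (fun k => ((2 * Real.pi * ‖a k‖ ^ 2 : ℝ) : ℂ)) =
        (fun p : ℕ × ℕ => a p.1 * conj (a p.2) *
          if n p.1 = n p.2 then 2 * (Real.pi : ℂ) else 0) ∘ fun k => (k, k) := by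
      ext k
      simp [Complex.mul_conj', mul_comm]
    rwa [← hterm] at hseries
  · rintro ⟨k, l⟩ hkl
    have : n k ≠ n l := fun h => hkl ⟨k, by simp [hn h]⟩
    simp [this]

theorem mul_deriv_exp_lacunary_div {z : ℂ} (hz : z ∈ Metric.ball (0:ℂ) 1) :
    z * deriv (fun w : ℂ =>
          Complex.exp (Complex.I / 2 * ∑' k : ℕ, w ^ (2 ^ (k + 1)) / ((k : ℂ) + 1) ^ 2)) z /
        Complex.exp (Complex.I / 2 * ∑' k : ℕ, z ^ (2 ^ (k + 1)) / ((k : ℂ) + 1) ^ 2)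
      = Complex.I / 2 *
          ∑' k : ℕ, ((2 : ℂ) ^ (k + 1) / ((k : ℂ) + 1) ^ 2) * z ^ (2 ^ (k + 1)) := by
  have hu : Summable fun k : ℕ => 1 / ((k : ℝ) + 1) ^ 2 := by
    have := (summable_nat_add_iff 1).2 (Real.summable_one_div_nat_pow.2 one_lt_two)
    simpa using this
  have hdiff (k : ℕ) : DifferentiableOn ℂ (fun w : ℂ => w ^ (2 ^ (k + 1)) / ((k : ℂ) + 1) ^ 2)
      (Metric.ball 0 1) := by fun_prop
  have hle (k : ℕ) (w : ℂ) (hw : w ∈ Metric.ball (0:ℂ) 1) :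
      ‖w ^ (2 ^ (k + 1)) / ((k : ℂ) + 1) ^ 2‖ ≤ 1 / ((k : ℝ) + 1) ^ 2 := by
    have hk : ‖(k : ℂ) + 1‖ = (k : ℝ) + 1 := by
      exact_mod_cast Complex.norm_natCast (k + 1)
    rw [norm_div, norm_pow, norm_pow, hk]
    gcongr
    exact pow_le_one₀ (norm_nonneg _) (mem_ball_zero_iff.1 hw).le
  have hd := Complex.hasSum_deriv_of_summable_norm hu hdiff Metric.isOpen_ball hle hz
  have hD := ((Complex.differentiableOn_tsum_of_summable_norm hu hdiff Metric.isOpen_ball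
    hle).differentiableAt (Metric.isOpen_ball.mem_nhds hz)).hasDerivAt
  rw [((hD.const_mul (Complex.I / 2)).cexp).deriv, ← hd.tsum_eq, mul_div_assoc,
    mul_div_cancel_left₀ _ (Complex.exp_ne_zero _), mul_left_comm, ← tsum_mul_left]
  congr 2
  ext k
  rw [deriv_div_const, deriv_pow_field, mul_div_assoc', mul_left_comm, ← pow_succ',
    Nat.sub_add_cancel Nat.one_le_two_pow]
  push_cast
  ring

theorem summable_lacunary_coeff {r : ℝ} (hr : r ∈ Ioo (0:ℝ) 1) :
    Summable fun k : ℕ => (2 : ℝ) ^ (k + 1) / ((k : ℝ) + 1) ^ 2 * r ^ (2 ^ (k + 1)) := by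
  have h := summable_pow_mul_geometric_of_norm_lt_one 1
    (show ‖r‖ < 1 by rw [Real.norm_of_nonneg hr.1.le]; exact hr.2)
  have hinj : Function.Injective fun k : ℕ => 2 ^ (k + 1) := fun k l hkl =>
    Nat.succ_injective (Nat.pow_right_injective le_rfl hkl)
  have hr0 := hr.1
  refine (h.comp_injective hinj).of_nonneg_of_le (fun k => by positivity) fun k => ?_
  simp only [Function.comp_apply, pow_one, Nat.cast_pow, Nat.cast_ofNat]
  gcongr
  refine div_le_self (by positivity) (one_le_pow₀ ?_)
  have := Nat.cast_nonneg (α := ℝ) k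
  linarith

/-- For `p*(z) = exp((i/2) ∑_{k≥1} z^{2^k}/k²)` one has
`z p*'(z)/p*(z) = (i/2) ∑_{k≥1} (2^k/k²) z^{2^k}` on `𝔻` and
`I_{p*}(r) = 2π ∑_{k≥1} (4^{k-1}/k⁴) r^{2^{k+1}}` for `0 < r < 1`
(indexed here by `k+1`, `k : ℕ`). -/
theorem stmt12 :
    (∀ z ∈ Metric.ball (0:ℂ) 1,
      z * deriv (fun w : ℂ =>
            Complex.exp (Complex.I / 2 * ∑' k : ℕ, w ^ (2 ^ (k + 1)) / ((k : ℂ) + 1) ^ 2)) z /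
          Complex.exp (Complex.I / 2 * ∑' k : ℕ, z ^ (2 ^ (k + 1)) / ((k : ℂ) + 1) ^ 2)
        = Complex.I / 2 *
            ∑' k : ℕ, ((2 : ℂ) ^ (k + 1) / ((k : ℂ) + 1) ^ 2) * z ^ (2 ^ (k + 1))) ∧
    ∀ r ∈ Set.Ioo (0:ℝ) 1,
      Ip (fun w : ℂ =>
            Complex.exp (Complex.I / 2 * ∑' k : ℕ, w ^ (2 ^ (k + 1)) / ((k : ℂ) + 1) ^ 2)) r
        = 2 * Real.pi * ∑' k : ℕ, ((4 : ℝ) ^ k / ((k : ℝ) + 1) ^ 4) * r ^ (2 ^ (k + 2)) := by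
  refine ⟨fun z hz => mul_deriv_exp_lacunary_div hz, fun r hr => ?_⟩
  have hr0 := hr.1
  set a : ℕ → ℂ := fun k =>
    Complex.I / 2 * ((2 : ℂ) ^ (k + 1) / ((k : ℂ) + 1) ^ 2 * r ^ (2 ^ (k + 1))) with ha
  have hnorm (k : ℕ) :
      ‖a k‖ = 1 / 2 * ((2 : ℝ) ^ (k + 1) / ((k : ℝ) + 1) ^ 2 * r ^ (2 ^ (k + 1))) := by
    have hk : ‖(k : ℂ) + 1‖ = (k : ℝ) + 1 := by
      exact_mod_cast Complex.norm_natCast (k + 1)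
    simp [ha, hk, abs_of_pos hr0]
  have hsum : Summable fun k => ‖a k‖ := by
    simpa only [hnorm] using (summable_lacunary_coeff hr).mul_left (1 / 2)
  have hinj : Function.Injective fun k : ℕ => 2 ^ (k + 1) := fun k l hkl =>
    Nat.succ_injective (Nat.pow_right_injective le_rfl hkl)
  have hmain := (hasSum_integral_norm_tsum_sq hsum hinj).tsum_eq
  rw [tsum_mul_left] at hmain
  have hseries : ∀ θ : ℝ, Complex.I / 2 * ∑' k : ℕ, ((2 : ℂ) ^ (k + 1) / ((k : ℂ) + 1) ^ 2) *
      (r * Complex.exp (θ * Complex.I)) ^ (2 ^ (k + 1)) =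
      ∑' k, a k * Complex.exp (θ * Complex.I) ^ (2 ^ (k + 1)) := by
    intro θ
    rw [← tsum_mul_left]
    congr 1
    ext k
    rw [ha, mul_pow]
    ring
  have hball (θ : ℝ) : (r : ℂ) * Complex.exp (θ * Complex.I) ∈ Metric.ball (0:ℂ) 1 := by
    simpa [Complex.norm_exp_ofReal_mul_I, abs_of_pos hr0] using hr.2
  simp only [Ip, mul_deriv_exp_lacunary_div (hball _), hseries]
  rw [← hmain]
  congr 2
  ext k
  have h4 : (4 : ℝ) ^ k = 2 ^ k * 2 ^ k := by rw [← mul_pow]; norm_num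
  have hr2 : r ^ (2 ^ (k + 2)) = r ^ (2 ^ (k + 1)) * r ^ (2 ^ (k + 1)) := by
    rw [← pow_add]; congr 1; ring
  rw [hnorm, h4, hr2]
  field_simp
  ring
end
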